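/- If e and w both lie in 𝒜 (respectively, both lie in ℬ) and e + w ∈ Φ, then the only element of Φ of the form n·e + m·w with n, m positive integers is e + w itself; that is, {n·e + m·w : n ≥ 1, m ≥ 1} ∩ Φ = {e + w}. -/

import Mathlib

/-- The invariant quadratic form of the rank two root system, on whose real roots it takes
the values `a` and `b`. -/
def rootForm (a b : ℤ) (x : ℤ × ℤ) : ℤ :=
  b * x.1 ^ 2 - a * b * x.1 * x.2 + a * x.2 ^ 2

/-- The polar bilinear form of `rootForm`. -/
def rootPolar (a b : ℤ) (x y : ℤ × ℤ) : ℤ :=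
  2 * b * x.1 * y.1 - a * b * (x.1 * y.2 + y.1 * x.2) + 2 * a * x.2 * y.2

lemma rootForm_neg (a b : ℤ) (x : ℤ × ℤ) : rootForm a b (-x) = rootForm a b x := by
  simp [rootForm]

lemma rootForm_nsmul_add_nsmul (a b : ℤ) (x y : ℤ × ℤ) (n m : ℕ) :
    rootForm a b (n • x + m • y) =
      n ^ 2 * rootForm a b x + m ^ 2 * rootForm a b y + n * m * rootPolar a b x y := by
  simp only [rootForm, rootPolar, Prod.fst_add, Prod.snd_add, Prod.smul_fst, Prod.smul_snd]
  simp only [nsmul_eq_mul]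
  ring

lemma rootForm_add (a b : ℤ) (x y : ℤ × ℤ) :
    rootForm a b (x + y) = rootForm a b x + rootForm a b y + rootPolar a b x y := by
  simpa using rootForm_nsmul_add_nsmul a b x y 1 1

/-- Two vectors in the same component of the region where `rootForm` is positive pair
nonnegatively. -/
lemma rootPolar_nonneg {a b : ℤ} (ha : 0 < a) (hb : 0 < b) (hab : 4 ≤ a * b) {x y : ℤ × ℤ}
    (hx : 0 < rootForm a b x) (hy : 0 < rootForm a b y)
    (hxy : 0 < (2 * x.1 - a * x.2) * (2 * y.1 - a * y.2)) : 0 ≤ rootPolar a b x y := by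
  obtain ⟨x₁, x₂⟩ := x
  obtain ⟨y₁, y₂⟩ := y
  simp only [rootForm, rootPolar] at *
  have hk : 0 ≤ a * (a * b - 4) := mul_nonneg ha.le (by linarith)
  have hx' : a * (a * b - 4) * x₂ ^ 2 ≤ b * (2 * x₁ - a * x₂) ^ 2 := by linarith
  have hy' : a * (a * b - 4) * y₂ ^ 2 ≤ b * (2 * y₁ - a * y₂) ^ 2 := by linarith
  have hmul := mul_le_mul hx' hy' (by positivity) (by positivity)
  have hsq : (a * (a * b - 4) * x₂ * y₂) ^ 2 ≤
      (b * ((2 * x₁ - a * x₂) * (2 * y₁ - a * y₂))) ^ 2 := by linarith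
  have := abs_le_of_sq_le_sq hsq (by positivity)
  linarith [le_abs_self (a * (a * b - 4) * x₂ * y₂)]

lemma rootForm_of_recurrence {a b : ℤ} {c d : ℕ → ℤ}
    (hc0 : c 0 = 0) (hd0 : d 0 = 0) (hc1 : c 1 = 1) (hd1 : d 1 = 1)
    (hcrec : ∀ n : ℕ, c (n + 2) = b * d (n + 1) - c n)
    (hdrec : ∀ n : ℕ, d (n + 2) = a * c (n + 1) - d n) (n : ℕ) :
    (rootForm a b (d (n + 1), c n) = a ∨ rootForm a b (d (n + 1), c n) = b) ∧
      (rootForm a b (d n, c (n + 1)) = a ∨ rootForm a b (d n, c (n + 1)) = b) := by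
  induction n with
  | zero => simp [rootForm, hc0, hd0, hc1, hd1]
  | succ k ih =>
    have h₁ : rootForm a b (d (k + 2), c (k + 1)) = rootForm a b (d k, c (k + 1)) := by
      simp only [rootForm, hdrec]
      ring
    have h₂ : rootForm a b (d (k + 1), c (k + 2)) = rootForm a b (d (k + 1), c k) := by
      simp only [rootForm, hcrec]
      ring
    exact ⟨h₁ ▸ ih.2, h₂ ▸ ih.1⟩

lemma lt_add_two_of_recurrence {a b : ℤ} (ha : 0 < a) (hab4 : 4 ≤ a * b) {c d : ℕ → ℤ}
    (hc0 : c 0 = 0) (hd0 : d 0 = 0) (hc1 : c 1 = 1) (hd1 : d 1 = 1)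
    (hcrec : ∀ n : ℕ, c (n + 2) = b * d (n + 1) - c n)
    (hdrec : ∀ n : ℕ, d (n + 2) = a * c (n + 1) - d n) (n : ℕ) :
    0 ≤ d n ∧ d n < d (n + 2) := by
  induction n using Nat.twoStepInduction with
  | zero => simp [hdrec, hc1, hd0, ha]
  | one =>
    have h : d 3 = a * (b * 1 - 0) - 1 := by rw [hdrec 1, hcrec 0, hc0, hd1]
    refine ⟨by simp [hd1], ?_⟩
    rw [hd1, h]
    linarith
  | more k ih _ =>
    have h : d (k + 4) = (a * b - 2) * d (k + 2) - d k := by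
      rw [hdrec (k + 2), hcrec (k + 1)]
      linear_combination hdrec k
    have hk : 0 ≤ d (k + 2) := ih.1.trans ih.2.le
    refine ⟨hk, ?_⟩
    rw [h]
    nlinarith [ih.2, mul_nonneg (sub_nonneg.2 hab4) hk]

lemma mul_lt_two_mul_of_recurrence {a b : ℤ} (ha : 0 < a) (hab4 : 4 ≤ a * b) {c d : ℕ → ℤ}
    (hc0 : c 0 = 0) (hd0 : d 0 = 0) (hc1 : c 1 = 1) (hd1 : d 1 = 1)
    (hcrec : ∀ n : ℕ, c (n + 2) = b * d (n + 1) - c n)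
    (hdrec : ∀ n : ℕ, d (n + 2) = a * c (n + 1) - d n) (n : ℕ) :
    a * c n < 2 * d (n + 1) ∧ 2 * d n < a * c (n + 1) := by
  have hlt k := (lt_add_two_of_recurrence ha hab4 hc0 hd0 hc1 hd1 hcrec hdrec k).2
  refine ⟨?_, by linarith [hlt n, hdrec n]⟩
  cases n with
  | zero => simp [hc0, hd1]
  | succ k => linarith [hlt k, hdrec k]

/-- If all values of `rootForm` involved lie in `{a, b}` and the polar form is nonnegative,
then `e + w` is the only positive combination of `e` and `w` on which `rootForm` takes
such a value. -/
lemma eq_one_of_rootForm_mem {a b : ℤ} (ha : 0 < a) (hab : a ≤ b) {e w : ℤ × ℤ}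
    (he : rootForm a b e = a ∨ rootForm a b e = b)
    (hw : rootForm a b w = a ∨ rootForm a b w = b)
    (hew : 0 ≤ rootPolar a b e w)
    (hsum : rootForm a b (e + w) = a ∨ rootForm a b (e + w) = b)
    {n m : ℕ} (hn : 0 < n) (hm : 0 < m)
    (hnm : rootForm a b (n • e + m • w) = a ∨ rootForm a b (n • e + m • w) = b) :
    n = 1 ∧ m = 1 := by
  rw [rootForm_add] at hsum
  rw [rootForm_nsmul_add_nsmul] at hnm
  have he' : rootForm a b e = a := by omega
  have hw' : rootForm a b w = a := by omega
  have hpolar : 2 * a + rootPolar a b e w = b := by omega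
  rw [he', hw'] at hnm
  have hn' : (1 : ℤ) ≤ n := by exact_mod_cast hn
  have hm' : (1 : ℤ) ≤ m := by exact_mod_cast hm
  have hle : (n : ℤ) ^ 2 * a + m ^ 2 * a + n * m * rootPolar a b e w ≤
      2 * a + rootPolar a b e w := by omega
  have hprod : rootPolar a b e w ≤ n * m * rootPolar a b e w :=
    le_mul_of_one_le_left hew (one_le_mul_of_one_le_of_one_le hn' hm')
  have hsq : (n : ℤ) ^ 2 + m ^ 2 ≤ 2 := le_of_mul_le_mul_right (by linarith) ha
  constructor <;> zify <;> nlinarith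

theorem stmt13 (a b : ℤ) (ha : 0 < a) (hab : a ≤ b) (hab4 : 4 ≤ a * b)
    (c d : ℕ → ℤ)
    (hc0 : c 0 = 0) (hd0 : d 0 = 0) (hc1 : c 1 = 1) (hd1 : d 1 = 1)
    (hcrec : ∀ n : ℕ, c (n + 2) = b * d (n + 1) - c n)
    (hdrec : ∀ n : ℕ, d (n + 2) = a * c (n + 1) - d n)
    (u v ub vb : ℕ → ℤ × ℤ)
    (hu : ∀ i, u i = (d (2 * i + 1), c (2 * i)))
    (hv : ∀ i, v i = (d (2 * i), c (2 * i + 1)))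
    (hub : ∀ i, ub i = (d (2 * i + 2), c (2 * i + 1)))
    (hvb : ∀ i, vb i = (d (2 * i + 1), c (2 * i + 2)))
    (A B Pos Phi : Set (ℤ × ℤ))
    (hA : A = {x | ∃ i, x = u i ∨ x = ub i})
    (hB : B = {x | ∃ i, x = v i ∨ x = vb i})
    (hPos : Pos = A ∪ B)
    (hPhi : Phi = Pos ∪ {x | -x ∈ Pos}) :
    ∀ e w : ℤ × ℤ, ((e ∈ A ∧ w ∈ A) ∨ (e ∈ B ∧ w ∈ B)) → e + w ∈ Phi →
      {x : ℤ × ℤ | ∃ n m : ℕ, 0 < n ∧ 0 < m ∧ x = n • e + m • w} ∩ Phi = {e + w} := by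
  have hb : 0 < b := ha.trans_le hab
  have hform := rootForm_of_recurrence hc0 hd0 hc1 hd1 hcrec hdrec
  have hsign := mul_lt_two_mul_of_recurrence ha hab4 hc0 hd0 hc1 hd1 hcrec hdrec
  have hA' : ∀ x ∈ A, ∃ n, x = (d (n + 1), c n) := by
    rw [hA]
    rintro x ⟨i, rfl | rfl⟩
    exacts [⟨2 * i, hu i⟩, ⟨2 * i + 1, hub i⟩]
  have hB' : ∀ x ∈ B, ∃ n, x = (d n, c (n + 1)) := by
    rw [hB]
    rintro x ⟨i, rfl | rfl⟩
    exacts [⟨2 * i, hv i⟩, ⟨2 * i + 1, hvb i⟩]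
  have hposForm : ∀ x ∈ Pos, rootForm a b x = a ∨ rootForm a b x = b := by
    rw [hPos]
    rintro x (hx | hx)
    · obtain ⟨n, rfl⟩ := hA' x hx
      exact (hform n).1
    · obtain ⟨n, rfl⟩ := hB' x hx
      exact (hform n).2
  have hphiForm : ∀ x ∈ Phi, rootForm a b x = a ∨ rootForm a b x = b := by
    rw [hPhi]
    rintro x (hx | hx)
    · exact hposForm x hx
    · exact rootForm_neg a b x ▸ hposForm (-x) hx
  intro e w h hsum
  have he : e ∈ Pos := by
    rw [hPos]
    exact h.imp And.left And.left
  have hw : w ∈ Pos := by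
    rw [hPos]
    exact h.imp And.right And.right
  have hpos : ∀ x ∈ Pos, 0 < rootForm a b x := fun x hx => by
    rcases hposForm x hx with h | h <;> rwa [h]
  have hcomp : 0 < (2 * e.1 - a * e.2) * (2 * w.1 - a * w.2) := by
    rcases h with ⟨h₁, h₂⟩ | ⟨h₁, h₂⟩
    · obtain ⟨n, rfl⟩ := hA' e h₁
      obtain ⟨m, rfl⟩ := hA' w h₂
      exact mul_pos (sub_pos.2 (hsign n).1) (sub_pos.2 (hsign m).1)
    · obtain ⟨n, rfl⟩ := hB' e h₁
      obtain ⟨m, rfl⟩ := hB' w h₂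
      exact mul_pos_of_neg_of_neg (sub_neg.2 (hsign n).2) (sub_neg.2 (hsign m).2)
  have hpolar := rootPolar_nonneg ha hb hab4 (hpos e he) (hpos w hw) hcomp
  ext x
  constructor
  · rintro ⟨⟨n, m, hn, hm, rfl⟩, hx⟩
    obtain ⟨rfl, rfl⟩ := eq_one_of_rootForm_mem ha hab (hposForm e he) (hposForm w hw) hpolar
      (hphiForm _ hsum) hn hm (hphiForm _ hx)
    simp
  · rintro rfl
    exact ⟨⟨1, 1, one_pos, one_pos, by simp⟩, hsum⟩
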